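/- Let n be a positive natural number, let Λ be the group algebra of ℝⁿ over ℝ (AddMonoidAlgebra ℝ (Fin n → ℝ)), and for β ∈ ℝⁿ let e^β denote the monomial supported at β. Let β₁, β₂ ∈ ℝⁿ with β₁ ≠ β₂ and set x = e^{β₁}, y = e^{β₂}. Then for every integer p ≥ 1, both Σ_{i=0}^{⌊p/2⌋} C(p,2i)·(x+y)^{p−2i}·(4xy)^i ≠ 0 and Σ_{i=0}^{⌊(p−1)/2⌋} C(p,2i+1)·(x+y)^{p−2i−1}·(4xy)^i ≠ 0 in Λ, where C(p,k) denotes the binomial coefficient. -/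

import Mathlib

noncomputable section

/-- The Novikov monomial e^β in the group algebra of ℝⁿ over ℝ. -/
def En (n : ℕ) (β : Fin n → ℝ) : AddMonoidAlgebra ℝ (Fin n → ℝ) :=
  AddMonoidAlgebra.single β 1

/-- The augmentation of the group algebra, sending every monomial e^β to 1. -/
def augmentation (n : ℕ) : AddMonoidAlgebra ℝ (Fin n → ℝ) →ₐ[ℝ] ℝ :=
  AddMonoidAlgebra.lift ℝ ℝ (Fin n → ℝ) 1

lemma augmentation_En (n : ℕ) (β : Fin n → ℝ) : augmentation n (En n β) = 1 := by
  simp [augmentation, En]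

/-- With x = e^{β₁}, y = e^{β₂} for β₁ ≠ β₂ in ℝⁿ, both coefficient sums of
(u+v)^{2p} are nonzero in the group algebra, for every p ≥ 1. -/
theorem coefficient_sums_nonzero
    (n : ℕ) (hn : 0 < n) (β₁ β₂ : Fin n → ℝ) (hβ : β₁ ≠ β₂)
    (p : ℕ) (hp : 1 ≤ p) :
    (∑ i ∈ Finset.range (p / 2 + 1),
        (p.choose (2 * i) : AddMonoidAlgebra ℝ (Fin n → ℝ)) *
          (En n β₁ + En n β₂) ^ (p - 2 * i) * (4 * En n β₁ * En n β₂) ^ i) ≠ 0 ∧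
    (∑ i ∈ Finset.range ((p - 1) / 2 + 1),
        (p.choose (2 * i + 1) : AddMonoidAlgebra ℝ (Fin n → ℝ)) *
          (En n β₁ + En n β₂) ^ (p - 2 * i - 1) * (4 * En n β₁ * En n β₂) ^ i) ≠ 0 := by
  constructor
  · refine ne_of_apply_ne (augmentation n) (ne_of_gt ?_)
    simp only [map_zero, map_sum, map_mul, map_pow, map_add, map_natCast, map_ofNat,
      augmentation_En]
    refine Finset.sum_pos (fun i hi => ?_) (by simp)
    have hi' : 2 * i ≤ p := by rw [Finset.mem_range] at hi; omega
    have := Nat.choose_pos hi'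
    positivity
  · refine ne_of_apply_ne (augmentation n) (ne_of_gt ?_)
    simp only [map_zero, map_sum, map_mul, map_pow, map_add, map_natCast, map_ofNat,
      augmentation_En]
    refine Finset.sum_pos (fun i hi => ?_) (by simp)
    have hi' : 2 * i + 1 ≤ p := by rw [Finset.mem_range] at hi; omega
    have := Nat.choose_pos hi'
    positivity

end
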